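/- For n ≥ 9, the maximum of f(P(n,2),M) over all type-1 perfect matchings M of P(n,2) equals ⌈n/4⌉. -/

import Mathlib

open SimpleGraph

/-- Vertices of the generalized Petersen graph `P(n,2)`:
`Sum.inl i` is the outer vertex `u_i`, `Sum.inr i` is the inner vertex `v_i`. -/
abbrev PV (n : ℕ) := ZMod n ⊕ ZMod n

/-- The outer vertex `u_i`. -/
def pu {n : ℕ} (i : ZMod n) : PV n := Sum.inl i

/-- The inner vertex `v_i`. -/
def pv {n : ℕ} (i : ZMod n) : PV n := Sum.inr i

/-- The generalized Petersen graph `P(n,2)`, with edges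
`u_i u_{i+2}`, `u_i v_i` (spokes) and `v_i v_{i+1}`, indices mod `n`. -/
def petersen (n : ℕ) : SimpleGraph (PV n) :=
  SimpleGraph.fromRel (fun x y =>
    (∃ i : ZMod n, x = pu i ∧ y = pu (i + 2)) ∨
    (∃ i : ZMod n, x = pu i ∧ y = pv i) ∨
    (∃ i : ZMod n, x = pv i ∧ y = pv (i + 1)))

/-- `S` is a forcing set of the perfect matching `M` of `G`:
`S ⊆ M` and `S` is contained in no other perfect matching of `G`. -/
def IsForcingSet {V : Type*} (G : SimpleGraph V) (M : G.Subgraph) (S : Set (Sym2 V)) : Prop :=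
  S ⊆ M.edgeSet ∧
    ∀ M' : G.Subgraph, M'.IsPerfectMatching → S ⊆ M'.edgeSet → M' = M

/-- The forcing number `f(G,M)`: the minimum cardinality of a forcing set of `M`. -/
noncomputable def forcingNumber {V : Type*} (G : SimpleGraph V) (M : G.Subgraph) : ℕ :=
  sInf {k | ∃ S : Set (Sym2 V), IsForcingSet G M S ∧ S.ncard = k}

/-- Block `A` starting at position `i` (length 4). -/
def blockA (n : ℕ) (i : ZMod n) : Set (Sym2 (PV n)) :=
  {s(pu i, pu (i + 2)), s(pu (i + 1), pu (i + 3)), s(pv i, pv (i + 1)), s(pv (i + 2), pv (i + 3))}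

/-- Block `B` at position `i` (length 1): a single spoke. -/
def blockB (n : ℕ) (i : ZMod n) : Set (Sym2 (PV n)) :=
  {s(pu i, pv i)}

/-- Block `C` starting at position `i` (length 3). -/
def blockC (n : ℕ) (i : ZMod n) : Set (Sym2 (PV n)) :=
  {s(pu i, pu (i + 2)), s(pu (i + 1), pv (i + 1)), s(pv (i + 2), pv (i + 3))}

/-- Block `D` starting at position `i` (length 4). -/
def blockD (n : ℕ) (i : ZMod n) : Set (Sym2 (PV n)) :=
  {s(pu i, pu (i + 2)), s(pu (i + 1), pu (i + 3)), s(pv (i + 1), pv (i + 2)), s(pv (i + 3), pv (i + 4))}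

/-- Length of an `A`/`B` block: `true` codes `A` (length 4), `false` codes `B` (length 1). -/
def abLen (b : Bool) : ℕ := if b then 4 else 1

/-- Edge set of a concatenation of `A`/`B` blocks starting at position `i`. -/
def abEdges (n : ℕ) : ZMod n → List Bool → Set (Sym2 (PV n))
  | _, [] => ∅
  | i, true :: L => blockA n i ∪ abEdges n (i + 4) L
  | i, false :: L => blockB n i ∪ abEdges n (i + 1) L

/-- A perfect matching (given as a subgraph of `P(n,2)`) has type 1 if its edge set is
a cyclic concatenation of `A` and `B` blocks whose lengths sum to `n`. -/
def IsType1 {n : ℕ} (M : (petersen n).Subgraph) : Prop :=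
  ∃ (i : ZMod n) (L : List Bool), (L.map abLen).sum = n ∧ M.edgeSet = abEdges n i L

/-- Length of a `C`/`D` block: `true` codes `C` (length 3), `false` codes `D` (length 4). -/
def cdLen (b : Bool) : ℕ := if b then 3 else 4

/-- Edge set of a concatenation of `C`/`D` blocks starting at position `i`. -/
def cdEdges (n : ℕ) : ZMod n → List Bool → Set (Sym2 (PV n))
  | _, [] => ∅
  | i, true :: L => blockC n i ∪ cdEdges n (i + 3) L
  | i, false :: L => blockD n i ∪ cdEdges n (i + 4) L

/-- A perfect matching (given as a subgraph of `P(n,2)`) has type 2 if its edge set is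
a cyclic concatenation of `C` and `D` blocks whose lengths sum to `n`. -/
def IsType2 {n : ℕ} (M : (petersen n).Subgraph) : Prop :=
  ∃ (i : ZMod n) (L : List Bool), (L.map cdLen).sum = n ∧ M.edgeSet = cdEdges n i L

/-- Codes for the edges of `P(n,2)`, with integer positions: `outer k` stands for `u_k u_{k+2}`,
`spoke k` for `u_k v_k` and `inner k` for `v_k v_{k+1}`. -/
inductive EdgeCode
  | outer (k : ℤ)
  | spoke (k : ℤ)
  | inner (k : ℤ)

namespace EdgeCode

/-- Exactly one of three propositions holds. -/
def One (a b c : Prop) : Prop := (a ∨ b ∨ c) ∧ ¬(a ∧ b) ∧ ¬(a ∧ c) ∧ ¬(b ∧ c)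

/-- The set of edges `m` covers every vertex exactly once. -/
def IsPerfect (m : EdgeCode → Prop) : Prop :=
  ∀ k : ℤ, One (m (outer (k + 2))) (m (outer k)) (m (spoke (k + 2))) ∧
    One (m (inner (k + 1))) (m (inner k)) (m (spoke (k + 1)))

/-- No edge of `m` joins a position before `p` to a position from `p` on. -/
def IsCut (m : EdgeCode → Prop) (p : ℤ) : Prop :=
  ¬ m (outer (p - 2)) ∧ ¬ m (outer (p - 1)) ∧ ¬ m (inner (p - 1))

theorem IsPerfect.outer_at {m : EdgeCode → Prop} (h : IsPerfect m) (k : ℤ) :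
    One (m (outer k)) (m (outer (k - 2))) (m (spoke k)) := by
  simpa using (h (k - 2)).1

theorem IsPerfect.inner_at {m : EdgeCode → Prop} (h : IsPerfect m) (k : ℤ) :
    One (m (inner k)) (m (inner (k - 1))) (m (spoke k)) := by
  simpa using (h (k - 1)).2

/-- The set of edges `m` contains the consecutive blocks listed by `L` from position `p` on,
where `true` stands for a block `A` and `false` for a block `B`. -/
def Lay (m : EdgeCode → Prop) : ℤ → List Bool → Prop
  | _, [] => True
  | p, true :: L => (m (outer p) ∧ m (outer (p + 1)) ∧ m (inner p) ∧ m (inner (p + 2))) ∧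
      Lay m (p + 4) L
  | p, false :: L => m (spoke p) ∧ Lay m (p + 1) L

/-- The number of positions covered by a list of blocks. -/
def blockLen (L : List Bool) : ℕ := (L.map abLen).sum

/-- The edges in `S` belong to the blocks `L` laid from position `p`, and force these blocks when
there are cuts at both ends. -/
def ForcedBetween (p : ℤ) (L : List Bool) (S : List EdgeCode) : Prop :=
  (∀ m, Lay m p L → ∀ e ∈ S, m e) ∧
    ∀ m, IsPerfect m → IsCut m p → IsCut m (p + blockLen L) → (∀ e ∈ S, m e) → Lay m p L

/-- The edges in `S` belong to the blocks `L` laid from position `p`, and force these blocks, as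
well as a cut after them, when there is a cut at `p`. -/
def ForcedFrom (p : ℤ) (L : List Bool) (S : List EdgeCode) : Prop :=
  (∀ m, Lay m p L → ∀ e ∈ S, m e) ∧
    ∀ m, IsPerfect m → IsCut m p → (∀ e ∈ S, m e) → Lay m p L ∧ IsCut m (p + blockLen L)

theorem IsPerfect.window {m : EdgeCode → Prop} (h : IsPerfect m) (p : ℤ) (N : ℕ) :
    ∀ j ∈ List.range N,
      One (m (outer (p + j))) (m (outer (p + j - 2))) (m (spoke (p + j))) ∧
      One (m (inner (p + j))) (m (inner (p + j - 1))) (m (spoke (p + j))) :=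
  fun j _ => ⟨h.outer_at (p + j), h.inner_at (p + j)⟩

theorem lay_append (m : EdgeCode → Prop) (X Y : List Bool) (p : ℤ) :
    Lay m p (X ++ Y) ↔ Lay m p X ∧ Lay m (p + blockLen X) Y := by
  induction X generalizing p with
  | nil => simp [Lay, blockLen]
  | cons b X ih => cases b <;> simp [Lay, ih, blockLen, abLen, and_assoc, add_assoc]

theorem blockLen_append (X Y : List Bool) : blockLen (X ++ Y) = blockLen X + blockLen Y := by
  simp [blockLen]

theorem ForcedFrom.append {p : ℤ} {C L : List Bool} {S S' : List EdgeCode}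
    (hC : ForcedFrom p C S) (hL : ForcedBetween (p + blockLen C) L S') :
    ForcedBetween p (C ++ L) (S ++ S') := by
  refine ⟨fun m hm e he => ?_, fun m h hp hq hS => ?_⟩
  · rw [lay_append] at hm
    rcases List.mem_append.1 he with he | he
    exacts [hC.1 m hm.1 e he, hL.1 m hm.2 e he]
  · rw [lay_append]
    obtain ⟨h1, h2⟩ := hC.2 m h hp fun e he => hS e (List.mem_append_left _ he)
    refine ⟨h1, hL.2 m h h2 ?_ fun e he => hS e (List.mem_append_right _ he)⟩
    simpa [blockLen_append, add_assoc] using hq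

/-- Words, with forcing edges, that can be split off the front of a longer block word. -/
def chunks (p : ℤ) : List (List Bool × List EdgeCode) :=
  [([true], [inner p]),
   ([false, true], [inner (p + 1)]),
   ([false, false, false, false], [spoke (p + 3)]),
   ([false, false, true, true], [outer (p + 3), outer (p + 6)]),
   ([false, false, true, false, true], [inner (p + 4), inner (p + 7)]),
   ([false, false, true, false, false], [inner (p + 4), spoke (p + 7)]),
   ([false, false, false, true, true], [outer (p + 4), outer (p + 7)]),
   ([false, false, false, true, false, true], [inner (p + 5), inner (p + 8)]),
   ([false, false, false, true, false, false], [inner (p + 5), spoke (p + 8)])]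

theorem forcedFrom_of_mem_chunks (p : ℤ) :
    ∀ C ∈ chunks p, ForcedFrom p C.1 C.2 ∧ 4 * C.2.length ≤ blockLen C.1 := by
  simp only [chunks, List.forall_mem_cons]
  refine ⟨?_, ?_, ?_, ?_, ?_, ?_, ?_, ?_, ?_, ?_⟩
  all_goals try exact fun _ h => absurd h List.not_mem_nil
  all_goals
    refine ⟨⟨fun m hm => ?_, fun m h hp hS => ?_⟩, by simp [blockLen, abLen]⟩
    · simp_all [Lay, add_assoc]
    · have w := h.window p 13
      simp only [List.range_succ, List.range_zero, List.nil_append, List.cons_append,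
        List.forall_mem_cons, One, IsCut, Lay, blockLen, add_sub_assoc, add_assoc] at *
      norm_num [abLen] at *
      grind (splits := 20)

/-- The words with no prefix among `chunks`, with their forcing edges. -/
def tails (p : ℤ) : List (List Bool × List EdgeCode) :=
  [([], []), ([false], []), ([false, false], []), ([false, false, false], []),
   ([false, false, true], [outer (p + 3)]),
   ([false, false, true, false], [inner (p + 4)]),
   ([false, false, false, true], [outer (p + 4)]),
   ([false, false, false, true, false], [inner (p + 5)])]

theorem forcedBetween_of_mem_tails (p : ℤ) :
    ∀ C ∈ tails p, ForcedBetween p C.1 C.2 ∧ 4 * C.2.length ≤ blockLen C.1 := by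
  simp only [tails, List.forall_mem_cons]
  refine ⟨?_, ?_, ?_, ?_, ?_, ?_, ?_, ?_, ?_⟩
  all_goals try exact fun _ h => absurd h List.not_mem_nil
  all_goals
    refine ⟨⟨fun m hm => ?_, fun m h hp hq hS => ?_⟩, by simp [blockLen, abLen]⟩
    · simp_all [Lay, add_assoc]
    · have w := h.window p 9
      simp only [List.range_succ, List.range_zero, List.nil_append, List.cons_append,
        List.forall_mem_cons, One, IsCut, Lay, blockLen, add_sub_assoc, add_assoc] at *
        <;> norm_num [abLen] at * <;> grind (splits := 20)

theorem exists_forcedBetween : ∀ (L : List Bool) (p : ℤ),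
    ∃ S, ForcedBetween p L S ∧ 4 * S.length ≤ blockLen L := by
  have ext (p : ℤ) (L : List Bool) (C) (hC : C ∈ chunks p)
      (h : ∀ p, ∃ S, ForcedBetween p L S ∧ 4 * S.length ≤ blockLen L) :
      ∃ S, ForcedBetween p (C.1 ++ L) S ∧ 4 * S.length ≤ blockLen (C.1 ++ L) := by
    obtain ⟨hC, hlen⟩ := forcedFrom_of_mem_chunks p C hC
    obtain ⟨S, hS, hS'⟩ := h (p + blockLen C.1)
    refine ⟨_, hC.append hS, ?_⟩
    rw [blockLen_append, List.length_append]
    omega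
  have tail (p : ℤ) (C) (hC : C ∈ tails p) :
      ∃ S, ForcedBetween p C.1 S ∧ 4 * S.length ≤ blockLen C.1 :=
    ⟨C.2, forcedBetween_of_mem_tails p C hC⟩
  intro L
  induction hN : L.length using Nat.strong_induction_on generalizing L with
  | _ N ih =>
    subst hN
    intro p
    match L, ih with
    | true :: L, ih => exact ext p L ([true], _) (.head _) (ih _ (by simp) L rfl)
    | false :: true :: L, ih =>
      exact ext p L ([false, true], _) (.tail _ (.head _)) (ih _ (by simp) L rfl)
    | [], ih => exact tail p _ (.head _)
    | [false], ih => exact tail p _ (.tail _ (.head _))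
    | [false, false], ih => exact tail p _ (.tail _ (.tail _ (.head _)))
    | [false, false, false], ih => exact tail p _ (.tail _ (.tail _ (.tail _ (.head _))))
    | [false, false, true], ih => exact tail p (_, _) (by simp [tails]; rfl)
    | [false, false, true, false], ih => exact tail p (_, _) (by simp [tails]; rfl)
    | [false, false, false, true], ih => exact tail p (_, _) (by simp [tails]; rfl)
    | [false, false, false, true, false], ih => exact tail p (_, _) (by simp [tails]; rfl)
    | false :: false :: false :: false :: L, ih =>
      exact ext p L ([false, false, false, false], _) (by simp [chunks]; rfl)
        (ih _ (by simp; omega) L rfl)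
    | false :: false :: true :: true :: L, ih =>
      exact ext p L ([false, false, true, true], _) (by simp [chunks]; rfl)
        (ih _ (by simp; omega) L rfl)
    | false :: false :: true :: false :: true :: L, ih =>
      exact ext p L ([false, false, true, false, true], _) (by simp [chunks]; rfl)
        (ih _ (by simp; omega) L rfl)
    | false :: false :: true :: false :: false :: L, ih =>
      exact ext p L ([false, false, true, false, false], _) (by simp [chunks]; rfl)
        (ih _ (by simp; omega) L rfl)
    | false :: false :: false :: true :: true :: L, ih =>
      exact ext p L ([false, false, false, true, true], _) (by simp [chunks]; rfl)
        (ih _ (by simp; omega) L rfl)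
    | false :: false :: false :: true :: false :: true :: L, ih =>
      exact ext p L ([false, false, false, true, false, true], _) (by simp [chunks]; rfl)
        (ih _ (by simp; omega) L rfl)
    | false :: false :: false :: true :: false :: false :: L, ih =>
      exact ext p L ([false, false, false, true, false, false], _) (by simp [chunks]; rfl)
        (ih _ (by simp; omega) L rfl)

/-- Invariance of a set of edges under translation by `n`. -/
def IsPeriodic (n : ℕ) (m : EdgeCode → Prop) : Prop :=
  ∀ k : ℤ, (m (outer (k + n)) ↔ m (outer k)) ∧ (m (spoke (k + n)) ↔ m (spoke k)) ∧
    (m (inner (k + n)) ↔ m (inner k))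

theorem IsPeriodic.lay_add {n : ℕ} {m : EdgeCode → Prop} (h : IsPeriodic n m) (p : ℤ)
    (L : List Bool) : Lay m (p + n) L ↔ Lay m p L := by
  induction L generalizing p with
  | nil => rfl
  | cons b L ih =>
    cases b <;> simp only [Lay, add_right_comm p (n : ℤ), h _, ih]

theorem IsPeriodic.isCut_add {n : ℕ} {m : EdgeCode → Prop} (h : IsPeriodic n m) (p : ℤ) :
    IsCut m (p + n) ↔ IsCut m p := by
  simp only [IsCut, add_sub_right_comm p (n : ℤ), h _]

theorem IsPeriodic.lay_rotate {n : ℕ} {m : EdgeCode → Prop} (h : IsPeriodic n m) (p : ℤ)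
    {X Y : List Bool} (hn : blockLen (X ++ Y) = n) :
    Lay m (p + blockLen X) (Y ++ X) ↔ Lay m p (X ++ Y) := by
  have hn' : (blockLen X + blockLen Y : ℤ) = n := by
    rw [← hn, blockLen_append]; push_cast; rfl
  rw [lay_append, lay_append, add_assoc p, hn', h.lay_add, and_comm]

/-- The periodic configuration with blocks `L` from position `p` on is forced by at most `⌈n/4⌉` of
its edges. -/
def HasForcing (n : ℕ) (p : ℤ) (L : List Bool) : Prop :=
  ∃ S : List EdgeCode, S.length ≤ (n + 3) / 4 ∧
    (∀ m, IsPeriodic n m → Lay m p L → ∀ e ∈ S, m e) ∧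
    ∀ m, IsPerfect m → IsPeriodic n m → (∀ e ∈ S, m e) → Lay m p L

theorem HasForcing.of_rotate {n : ℕ} {p : ℤ} {X Y : List Bool} (hn : blockLen (X ++ Y) = n)
    (h : HasForcing n (p + blockLen X) (Y ++ X)) : HasForcing n p (X ++ Y) := by
  obtain ⟨S, hS, h1, h2⟩ := h
  exact ⟨S, hS, fun m hm hL => h1 m hm ((hm.lay_rotate p hn).2 hL),
    fun m hm hp hL => (hp.lay_rotate p hn).1 (h2 m hm hp hL)⟩

theorem exists_forcedFrom_replicate (j : ℕ) (p : ℤ) :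
    ∃ S, S.length = j ∧ ForcedFrom p (List.replicate j true) S := by
  induction j generalizing p with
  | zero => exact ⟨[], rfl, by simp, by simp +contextual [Lay, blockLen]⟩
  | succ j ih =>
    obtain ⟨S, hS, h1, h2⟩ := ih (p + 4)
    have hA := (forcedFrom_of_mem_chunks p ([true], [inner p]) (.head _)).1
    refine ⟨inner p :: S, by simp [hS], fun m hm => ?_, fun m h hp hm => ?_⟩
    · exact List.forall_mem_cons.2 ⟨hm.1.2.2.1, h1 m hm.2⟩
    · obtain ⟨hp', hS'⟩ := List.forall_mem_cons.1 hm
      obtain ⟨hl, hc⟩ := hA.2 m h hp (by simpa using hp')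
      obtain ⟨hl', hc'⟩ := h2 m h (by simpa [blockLen, abLen] using hc) hS'
      exact ⟨⟨hl.1, hl'⟩, by simpa [blockLen, abLen, add_assoc, List.replicate_succ] using hc'⟩

theorem hasForcing_replicate_true {n j : ℕ} (p : ℤ)
    (hn : blockLen (true :: true :: true :: List.replicate j true) = n) :
    HasForcing n p (true :: true :: true :: List.replicate j true) := by
  obtain ⟨S, hS, h1, h2⟩ := exists_forcedFrom_replicate j (p + 12)
  have hn' : n = 12 + blockLen (List.replicate j true) := by
    rw [← hn]; simp [blockLen, abLen]; omega
  have hn'' : n = 12 + 4 * j := by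
    rw [hn']; simp [blockLen, abLen]; omega
  refine ⟨outer p :: outer (p + 5) :: inner (p + 8) :: S, by simp [hS]; omega,
    fun m _ hm => ?_, fun m h hp hm => ?_⟩
  · simp only [Lay, List.forall_mem_cons, add_assoc] at hm ⊢
    norm_num at hm ⊢
    exact ⟨hm.1.1, hm.2.1.2.1, hm.2.2.1.2.2.1, h1 m hm.2.2.2⟩
  · simp only [List.forall_mem_cons] at hm
    obtain ⟨e0, e4, e8, hS'⟩ := hm
    have key : Lay m (p + 4) [true, true] ∧ IsCut m (p + 12) := by
      clear h2 hS' h1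
      have w := h.window p 13
      simp only [List.range_succ, List.range_zero, List.nil_append, List.cons_append,
        List.forall_mem_cons, One, IsCut, Lay, add_sub_assoc, add_assoc] at *
      norm_num at *
      grind (splits := 20)
    obtain ⟨hl, hc⟩ := h2 m h key.2 hS'
    have hc0 : IsCut m p := by
      rw [← hp.isCut_add, hn']
      simpa [add_assoc] using hc
    have first : Lay m p [true] := by
      have w := h.window p 5
      simp only [List.range_succ, List.range_zero, List.nil_append, List.cons_append,
        List.forall_mem_cons, One, IsCut, Lay, add_sub_assoc, add_assoc] at *
      norm_num at *
      grind (splits := 20)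
    have key := key.1
    simp only [Lay, add_assoc] at key first ⊢
    norm_num at key first ⊢
    exact ⟨first, key.1, key.2, hl⟩

/-- If two edges of an initial word of length `5` force that word together with cuts at both of its
ends, then the whole periodic configuration has a small forcing set. -/
theorem hasForcing_of_start {n : ℕ} (p : ℤ) {C L : List Bool} {e e' : EdgeCode}
    (hn : blockLen (C ++ L) = n) (hC : blockLen C = 5)
    (he : ∀ m, Lay m p C → m e ∧ m e')
    (hf : ∀ m, IsPerfect m → m e → m e' → Lay m p C ∧ IsCut m p ∧ IsCut m (p + 5)) :
    HasForcing n p (C ++ L) := by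
  obtain ⟨S, hS, hlen⟩ := exists_forcedBetween L (p + 5)
  rw [blockLen_append, hC] at hn
  refine ⟨e :: e' :: S, by simp; omega, fun m _ hm => ?_, fun m h hp hm => ?_⟩
  · rw [lay_append, hC] at hm
    simp only [List.forall_mem_cons]
    exact ⟨(he m hm.1).1, (he m hm.1).2, hS.1 m hm.2⟩
  · simp only [List.forall_mem_cons] at hm
    obtain ⟨hl, hc, hc'⟩ := hf m h hm.1 hm.2.1
    rw [lay_append, hC]
    refine ⟨hl, hS.2 m h hc' ?_ hm.2.2⟩
    rw [← hp.isCut_add, ← hn] at hc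
    simpa [add_assoc] using hc

theorem hasForcing_false_true {n : ℕ} (p : ℤ) {L : List Bool}
    (hn : blockLen (false :: true :: L) = n) : HasForcing n p (false :: true :: L) := by
  refine hasForcing_of_start (C := [false, true]) (e := spoke p) (e' := outer (p + 1)) p hn rfl
    (fun m hm => ⟨hm.1, hm.2.1.1⟩) fun m h h1 h2 => ?_
  have w := h.window p 6
  simp only [List.range_succ, List.range_zero, List.nil_append, List.cons_append,
    List.forall_mem_cons, One, IsCut, Lay, add_sub_assoc, add_assoc] at *
  norm_num at *
  grind (splits := 20)

theorem hasForcing_false_five {n : ℕ} (p : ℤ) {L : List Bool}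
    (hn : blockLen (false :: false :: false :: false :: false :: L) = n) :
    HasForcing n p (false :: false :: false :: false :: false :: L) := by
  refine hasForcing_of_start (C := [false, false, false, false, false]) (e := spoke p)
    (e' := spoke (p + 4)) p hn rfl
    (fun m hm => ⟨hm.1, by simpa [add_assoc] using hm.2.2.2.2.1⟩) fun m h h1 h2 => ?_
  have w := h.window p 6
  simp only [List.range_succ, List.range_zero, List.nil_append, List.cons_append,
    List.forall_mem_cons, One, IsCut, Lay, add_sub_assoc, add_assoc] at *
  norm_num at *
  grind (splits := 20)

theorem exists_false_true_of_mem {Z : List Bool} (h : true ∈ Z) :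
    ∃ P R, false :: Z = P ++ false :: true :: R := by
  induction Z with
  | nil => simp at h
  | cons b Z ih =>
    cases b with
    | true => exact ⟨[], Z, rfl⟩
    | false =>
      obtain ⟨P, R, hPR⟩ := ih (by simpa using h)
      exact ⟨false :: P, R, by rw [hPR]; rfl⟩

theorem hasForcing {n : ℕ} (hn : 9 ≤ n) (p : ℤ) {L : List Bool} (hL : blockLen L = n) :
    HasForcing n p L := by
  by_cases hT : true ∈ L
  · by_cases hF : false ∈ L
    · obtain ⟨X, Y, rfl⟩ := List.append_of_mem hF
      refine HasForcing.of_rotate hL ?_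
      have hZ : true ∈ Y ++ X := by simpa [or_comm] using hT
      obtain ⟨P, R, hPR⟩ := exists_false_true_of_mem hZ
      have hl : blockLen (P ++ false :: true :: R) = n := by
        rw [← hPR, ← hL]
        simp [blockLen, add_comm, add_left_comm]
      rw [List.cons_append, hPR]
      refine HasForcing.of_rotate hl (hasForcing_false_true _ ?_)
      rw [← hl]
      simp [blockLen, add_comm, add_left_comm]
    · obtain ⟨k, rfl⟩ : ∃ k, L = List.replicate k true :=
        ⟨_, List.eq_replicate_of_mem fun b hb => by cases b <;> simp_all⟩
      obtain ⟨j, rfl⟩ : ∃ j, k = j + 3 := ⟨k - 3, by simp [blockLen, abLen] at hL; omega⟩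
      exact hasForcing_replicate_true p hL
  · obtain ⟨k, rfl⟩ : ∃ k, L = List.replicate k false :=
      ⟨_, List.eq_replicate_of_mem fun b hb => by cases b <;> simp_all⟩
    obtain ⟨j, rfl⟩ : ∃ j, k = j + 5 := ⟨k - 5, by simp [blockLen, abLen] at hL; omega⟩
    exact hasForcing_false_five p hL

/-- The edge of `P(n,2)` with a given code. -/
def toEdge (n : ℕ) : EdgeCode → Sym2 (PV n)
  | outer k => s(pu (k : ZMod n), pu ((k : ZMod n) + 2))
  | spoke k => s(pu (k : ZMod n), pv (k : ZMod n))
  | inner k => s(pv (k : ZMod n), pv ((k : ZMod n) + 1))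

theorem toEdge_isPeriodic {n : ℕ} (T : Set (Sym2 (PV n))) :
    IsPeriodic n fun e => toEdge n e ∈ T := by
  intro k
  simp [toEdge]

theorem lay_iff_abEdges_subset {n : ℕ} (T : Set (Sym2 (PV n))) (p : ℤ) (L : List Bool) :
    Lay (fun e => toEdge n e ∈ T) p L ↔ abEdges n p L ⊆ T := by
  induction L generalizing p with
  | nil => simp [Lay, abEdges]
  | cons b L ih =>
    have h3 : (p : ZMod n) + 1 + 2 = p + 3 := by ring
    have h4 : (p : ZMod n) + 2 + 1 = p + 3 := by ring
    cases b <;> simp only [Lay, abEdges, ih, Set.union_subset_iff, blockA, blockB] <;>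
      simp [toEdge, Set.insert_subset_iff, h3, h4]

theorem one_of_existsUnique {α : Type*} {P : α → Prop} (h : ∃! x, P x) {a b c : α}
    (hab : a ≠ b) (hac : a ≠ c) (hbc : b ≠ c) (hP : ∀ x, P x → x = a ∨ x = b ∨ x = c) :
    One (P a) (P b) (P c) := by
  obtain ⟨x, hx, hu⟩ := h
  refine ⟨?_, fun h => hab ((hu _ h.1).trans (hu _ h.2).symm),
    fun h => hac ((hu _ h.1).trans (hu _ h.2).symm),
    fun h => hbc ((hu _ h.1).trans (hu _ h.2).symm)⟩
  rcases hP x hx with rfl | rfl | rfl <;> simp [hx]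

end EdgeCode

theorem petersen_adj_pu {n : ℕ} {i : ZMod n} {y : PV n} (h : (petersen n).Adj (pu (i + 2)) y) :
    y = pu (i + 4) ∨ y = pu i ∨ y = pv (i + 2) := by
  simp only [petersen, fromRel_adj, pu, pv] at h ⊢
  rcases h.2 with (⟨j, h1, h2⟩ | ⟨j, h1, h2⟩ | ⟨j, h1, h2⟩) |
      (⟨j, h1, h2⟩ | ⟨j, h1, h2⟩ | ⟨j, h1, h2⟩) <;>
    simp at h1 h2 <;> subst h1 <;> grind

theorem petersen_adj_pv {n : ℕ} {i : ZMod n} {y : PV n} (h : (petersen n).Adj (pv (i + 1)) y) :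
    y = pv (i + 2) ∨ y = pv i ∨ y = pu (i + 1) := by
  simp only [petersen, fromRel_adj, pu, pv] at h ⊢
  rcases h.2 with (⟨j, h1, h2⟩ | ⟨j, h1, h2⟩ | ⟨j, h1, h2⟩) |
      (⟨j, h1, h2⟩ | ⟨j, h1, h2⟩ | ⟨j, h1, h2⟩) <;>
    simp at h1 h2 <;> subst h1 <;> grind

theorem natCast_zmod_ne_zero {n k : ℕ} (hk : 0 < k) (hkn : k < n) : (k : ZMod n) ≠ 0 := by
  rw [Ne, ZMod.natCast_eq_zero_iff]
  exact Nat.not_dvd_of_pos_of_lt hk hkn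

open EdgeCode in
theorem isPerfect_of_isPerfectMatching {n : ℕ} (hn : 9 ≤ n) {M : (petersen n).Subgraph}
    (hM : M.IsPerfectMatching) : IsPerfect fun e => toEdge n e ∈ M.edgeSet := by
  have h2 : (2 : ZMod n) ≠ 0 := natCast_zmod_ne_zero (k := 2) (by omega) (by omega)
  have h4 : (4 : ZMod n) ≠ 0 := natCast_zmod_ne_zero (k := 4) (by omega) (by omega)
  rw [Subgraph.isPerfectMatching_iff] at hM
  intro k
  simp only [toEdge, Subgraph.mem_edgeSet]
  push_cast
  rw [M.adj_comm (pu (k : ZMod n)) _, M.adj_comm (pv (k : ZMod n)) _,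
    M.adj_comm _ (pv ((k : ZMod n) + 1)), add_assoc (k : ZMod n) 2 2, add_assoc (k : ZMod n) 1 1]
  norm_num
  constructor
  · refine one_of_existsUnique (hM _) ?_ ?_ ?_ fun y hy => petersen_adj_pu (M.adj_sub hy)
    all_goals simp [pu, pv, h4]
  · refine one_of_existsUnique (hM _) ?_ ?_ ?_ fun y hy => petersen_adj_pv (M.adj_sub hy)
    all_goals simp [pu, pv, h2]

theorem SimpleGraph.Subgraph.IsPerfectMatching.eq_of_edgeSet_subset {V : Type*}
    {G : SimpleGraph V} {M M' : G.Subgraph} (hM : M.IsPerfectMatching)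
    (hM' : M'.IsPerfectMatching) (h : M.edgeSet ⊆ M'.edgeSet) : M' = M := by
  have hadj {a b : V} (hab : M.Adj a b) : M'.Adj a b :=
    Subgraph.mem_edgeSet.1 (h (Subgraph.mem_edgeSet.2 hab))
  rw [Subgraph.isPerfectMatching_iff] at hM hM'
  refine Subgraph.ext ?_ (funext₂ fun a b => propext ⟨fun hab => ?_, hadj⟩)
  · ext v
    exact iff_of_true (M'.edge_vert (hM' v).choose_spec.1) (M.edge_vert (hM v).choose_spec.1)
  · obtain ⟨c, hc, -⟩ := hM a
    rwa [(hM' a).unique hab (hadj hc)]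

open EdgeCode in
theorem IsType1.exists_isForcingSet {n : ℕ} (hn : 9 ≤ n) {M : (petersen n).Subgraph}
    (hM : M.IsPerfectMatching) (h1 : IsType1 M) :
    ∃ S, IsForcingSet (petersen n) M S ∧ S.ncard ≤ (n + 3) / 4 := by
  classical
  obtain ⟨i, L, hL, hE⟩ := h1
  obtain ⟨p, rfl⟩ := ZMod.intCast_surjective i
  obtain ⟨S, hS, hSM, hforce⟩ := hasForcing hn p hL
  refine ⟨toEdge n '' {e | e ∈ S}, ⟨?_, fun M' hM' hS' => ?_⟩, ?_⟩
  · rintro _ ⟨e, he, rfl⟩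
    exact hSM _ (toEdge_isPeriodic M.edgeSet) ((lay_iff_abEdges_subset _ p L).2 hE.ge) e he
  · refine hM.eq_of_edgeSet_subset hM' ?_
    rw [hE, ← lay_iff_abEdges_subset]
    exact hforce _ (isPerfect_of_isPerfectMatching hn hM') (toEdge_isPeriodic _)
      fun e he => hS' (Set.mem_image_of_mem _ he)
  · have hfin : {e | e ∈ S}.Finite := List.finite_toSet S
    refine (Set.ncard_image_le hfin).trans (le_trans ?_ hS)
    have : {e | e ∈ S} = (S.toFinset : Set EdgeCode) := by ext; simp
    rw [this, Set.ncard_coe_finset]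
    exact S.toFinset_card_le

theorem IsType1.forcingNumber_le {n : ℕ} (hn : 9 ≤ n) {M : (petersen n).Subgraph}
    (hM : M.IsPerfectMatching) (h1 : IsType1 M) :
    forcingNumber (petersen n) M ≤ (n + 3) / 4 := by
  obtain ⟨S, hS, hcard⟩ := h1.exists_isForcingSet hn hM
  have hmem : S.ncard ∈ {k | ∃ S, IsForcingSet (petersen n) M S ∧ S.ncard = k} := ⟨S, hS, rfl⟩
  exact (Nat.sInf_le hmem).trans hcard

/-- The spanning subgraph joining each vertex to its image under an involution. -/
def SimpleGraph.Subgraph.ofInvolution {V : Type*} (G : SimpleGraph V) (f : V → V)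
    (hf : Function.Involutive f) (hG : ∀ x, G.Adj x (f x)) : G.Subgraph where
  verts := Set.univ
  Adj x y := f x = y
  adj_sub := by rintro x _ rfl; exact hG x
  edge_vert _ := trivial
  symm := ⟨by rintro x _ rfl; exact hf x⟩

theorem SimpleGraph.Subgraph.isPerfectMatching_ofInvolution {V : Type*} (G : SimpleGraph V)
    (f : V → V) (hf : Function.Involutive f) (hG : ∀ x, G.Adj x (f x)) :
    (Subgraph.ofInvolution G f hf hG).IsPerfectMatching :=
  Subgraph.isPerfectMatching_iff.2 fun x => ⟨f x, rfl, fun _ h => Eq.symm (a := f x) h⟩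

/-- The perfect matching consisting of all spokes. -/
def spokeMatching (n : ℕ) : (petersen n).Subgraph :=
  Subgraph.ofInvolution _ Sum.swap Sum.swap_swap fun x => by
    rw [petersen, fromRel_adj]
    rcases x with i | i
    · exact ⟨by simp, .inl (.inr (.inl ⟨i, rfl, rfl⟩))⟩
    · exact ⟨by simp, .inr (.inr (.inl ⟨i, rfl, rfl⟩))⟩

theorem spokeMatching_isPerfectMatching (n : ℕ) : (spokeMatching n).IsPerfectMatching :=
  Subgraph.isPerfectMatching_ofInvolution ..

theorem mem_edgeSet_spokeMatching {n : ℕ} {e : Sym2 (PV n)} :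
    e ∈ (spokeMatching n).edgeSet ↔ ∃ i : ZMod n, e = s(pu i, pv i) := by
  induction e with
  | _ x y =>
    constructor
    · rintro (rfl : Sum.swap x = y)
      rcases x with i | i
      · exact ⟨i, rfl⟩
      · exact ⟨i, Sym2.eq_swap⟩
    · rintro ⟨i, hi⟩
      rw [hi]
      exact (rfl : Sum.swap (pu i) = pv i)

theorem abEdges_replicate_false (n : ℕ) (i : ZMod n) (k : ℕ) :
    abEdges n i (List.replicate k false) =
      {e | ∃ j < k, e = s(pu (i + j : ZMod n), pv (i + j : ZMod n))} := by
  induction k generalizing i with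
  | zero => simp [abEdges]
  | succ k ih =>
    ext e
    simp only [List.replicate_succ, abEdges, ih, blockB, Set.mem_union, Set.mem_singleton_iff,
      Set.mem_ofPred_eq, Nat.exists_lt_succ_left]
    simp [add_assoc, add_comm (1 : ZMod n)]

theorem spokeMatching_isType1 {n : ℕ} (hn : 0 < n) : IsType1 (spokeMatching n) := by
  have : NeZero n := ⟨hn.ne'⟩
  refine ⟨0, List.replicate n false, by simp [abLen], ?_⟩
  ext e
  rw [abEdges_replicate_false, mem_edgeSet_spokeMatching]
  constructor
  · rintro ⟨i, rfl⟩
    exact ⟨i.val, ZMod.val_lt i, by simp⟩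
  · rintro ⟨j, -, rfl⟩
    exact ⟨_, rfl⟩

theorem zmod_small_ne {n : ℕ} (hn : 9 ≤ n) :
    (1 : ZMod n) ≠ 0 ∧ (2 : ZMod n) ≠ 0 ∧ (3 : ZMod n) ≠ 0 ∧
      (2 : ZMod n) ≠ 1 ∧ (3 : ZMod n) ≠ 1 ∧ (3 : ZMod n) ≠ 2 := by
  have h1 : (1 : ZMod n) ≠ 0 := by
    simpa using natCast_zmod_ne_zero (n := n) (k := 1) (by omega) (by omega)
  have h2 : (2 : ZMod n) ≠ 0 := natCast_zmod_ne_zero (k := 2) (by omega) (by omega)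
  have h3 : (3 : ZMod n) ≠ 0 := natCast_zmod_ne_zero (k := 3) (by omega) (by omega)
  refine ⟨h1, h2, h3, fun h => h1 ?_, fun h => h2 ?_, fun h => h1 ?_⟩ <;> linear_combination h

/-- The involution pairing the vertices along a block `A` at `a` and along spokes elsewhere. -/
def flipFun {n : ℕ} (a : ZMod n) : PV n → PV n
  | .inl i => if i = a then pu (a + 2) else if i = a + 1 then pu (a + 3)
      else if i = a + 2 then pu a else if i = a + 3 then pu (a + 1) else pv i
  | .inr i => if i = a then pv (a + 1) else if i = a + 1 then pv a
      else if i = a + 2 then pv (a + 3) else if i = a + 3 then pv (a + 2) else pu i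

theorem flipFun_involutive {n : ℕ} (hn : 9 ≤ n) (a : ZMod n) :
    Function.Involutive (flipFun a) := by
  obtain ⟨h1, h2, h3, h12, h13, h23⟩ := zmod_small_ne hn
  rintro (i | i) <;> simp only [flipFun] <;> split_ifs <;> simp_all [pu, pv]

theorem petersen_adj_flipFun {n : ℕ} (hn : 9 ≤ n) (a : ZMod n) (x : PV n) :
    (petersen n).Adj x (flipFun a x) := by
  obtain ⟨h1, h2, h3, h12, h13, h23⟩ := zmod_small_ne hn
  rw [petersen, fromRel_adj]
  rcases x with i | i <;> simp only [flipFun] <;> split_ifs <;> subst_vars <;>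
    simp_all [pu, pv, add_assoc] <;> norm_num <;> grind

/-- The perfect matching with a block `A` at `a` and spokes elsewhere. -/
def flippedMatching {n : ℕ} (hn : 9 ≤ n) (a : ZMod n) : (petersen n).Subgraph :=
  Subgraph.ofInvolution _ (flipFun a) (flipFun_involutive hn a) (petersen_adj_flipFun hn a)

theorem exists_spoke_mem_of_isForcingSet {n : ℕ} (hn : 9 ≤ n) {S : Set (Sym2 (PV n))}
    (hS : IsForcingSet (petersen n) (spokeMatching n) S) (a : ZMod n) :
    ∃ j : Fin 4, s(pu (a + (j : ℕ) : ZMod n), pv (a + (j : ℕ) : ZMod n)) ∈ S := by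
  by_contra! hcon
  have heq : flippedMatching hn a = spokeMatching n := by
    refine hS.2 _ (Subgraph.isPerfectMatching_ofInvolution ..) fun e he => ?_
    obtain ⟨i, rfl⟩ := mem_edgeSet_spokeMatching.1 (hS.1 he)
    have ha (j : Fin 4) : i ≠ a + (j : ℕ) := by
      rintro rfl
      exact hcon j he
    have h0 := ha 0
    have h1 := ha 1
    have h2 := ha 2
    have h3 := ha 3
    simp at h0 h1 h2 h3
    change flipFun a (pu i) = pv i
    simp [flipFun, pu, h0, h1, h2, h3]
  have hadj : (flippedMatching hn a).Adj (pu a) (pu (a + 2)) := by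
    change flipFun a (pu a) = _
    simp [flipFun, pu]
  rw [heq] at hadj
  exact Sum.inr_ne_inl (show Sum.swap (pu a) = pu (a + 2) from hadj)

theorem le_ncard_of_isForcingSet {n : ℕ} (hn : 9 ≤ n) {S : Set (Sym2 (PV n))}
    (hS : IsForcingSet (petersen n) (spokeMatching n) S) : (n + 3) / 4 ≤ S.ncard := by
  have : NeZero n := ⟨by omega⟩
  choose j hj using exists_spoke_mem_of_isForcingSet hn hS
  have hinj : Function.Injective fun a : ZMod n =>
      ((⟨_, hj a⟩, j a) : S × Fin 4) := by
    intro a b hab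
    simp only [Prod.mk.injEq, Subtype.mk.injEq] at hab
    obtain ⟨h1, h2⟩ := hab
    rw [h2] at h1
    simpa [pu, pv] using h1
  have hcard := Nat.card_le_card_of_injective _ hinj
  rw [Nat.card_prod, Nat.card_zmod, Nat.card_coe_set_eq, Nat.card_fin] at hcard
  omega

theorem forcingNumber_spokeMatching {n : ℕ} (hn : 9 ≤ n) :
    forcingNumber (petersen n) (spokeMatching n) = (n + 3) / 4 := by
  have hM := spokeMatching_isPerfectMatching n
  have h1 := spokeMatching_isType1 (n := n) (by omega)
  refine le_antisymm (h1.forcingNumber_le hn hM) ?_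
  obtain ⟨S, hS, -⟩ := h1.exists_isForcingSet hn hM
  obtain ⟨S', hS', hcard⟩ := Nat.sInf_mem
    (s := {k | ∃ S, IsForcingSet (petersen n) (spokeMatching n) S ∧ S.ncard = k}) ⟨_, S, hS, rfl⟩
  rw [forcingNumber, ← hcard]
  exact le_ncard_of_isForcingSet hn hS'

/-- for `n ≥ 9` the maximum forcing number over type-1 perfect matchings
of `P(n,2)` equals `⌈n/4⌉` (written `(n+3)/4` in natural division). -/
theorem type1_max_forcing (n : ℕ) (hn : 9 ≤ n) :
    IsGreatest {k | ∃ M : (petersen n).Subgraph,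
        M.IsPerfectMatching ∧ IsType1 M ∧ forcingNumber (petersen n) M = k}
      ((n + 3) / 4) := by
  refine ⟨⟨spokeMatching n, spokeMatching_isPerfectMatching n, spokeMatching_isType1 (by omega),
    forcingNumber_spokeMatching hn⟩, ?_⟩
  rintro _ ⟨M, hM, h1, rfl⟩
  exact h1.forcingNumber_le hn hM
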